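/- arXiv:2410.19126 — 10 statements merged into one kernel-verified Lean document; each statement's English description precedes it below -/
import Mathlib

section
/- Consistency of the anomalous symmetric condition with the surface fermionic pentagon equation (Abelian-gauge-theory surface, multiplicity free). Let G be a group, N an additive abelian group, μ : G×G → N, and let labels be pairs a_g with a ∈ N, g ∈ G, fused by a_g ⊗ b_h := (a+b+μ(g,h))_{gh}. Let S : G → ℤ/2 be a group homomorphism, and for a nonzero complex number z set z^{S(g)} := conjugate of z if S(g)=1, and z otherwise. Let ν₄ : G⁴ → ℂˣ, Θ : G × (N×G)³ → ℂˣ (write Θ^{g₀}(a_g,b_h,c_k)), and F¹ : (N×G)³ → ℂˣ. Assume: (i) the anomalous pentagon equation F¹(a_g⊗b_h, c_k, d_l)·F¹(a_g, b_h, c_k⊗d_l) = Θ^{g}(b_h,c_k,d_l)·ν₄(g,h,k,l)·F¹(a_g,b_h,c_k)·F¹(a_g, b_h⊗c_k, d_l)·(F¹(b_h,c_k,d_l))^{S(g)} for all labels; (ii) the fermionic-obstruction coboundary condition: Θ^{g₀}(a_g⊗b_h, c_k, d_l)·Θ^{g₀}(a_g, b_h, c_k⊗d_l)·ν₄(g₀,gh,k,l)·ν₄(g₀,g,h,kl)·(ν₄(g,h,k,l))^{S(g₀)}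 = Θ^{g₀}(a_g,b_h,c_k)·Θ^{g₀}(a_g, b_h⊗c_k, d_l)·Θ^{g₀}(b_h,c_k,d_l)·ν₄(g₀,g,h,k)·ν₄(g₀,g,hk,l)·ν₄(g₀g,h,k,l) for all g₀ and labels; (iii) Θ^{g₀}(x)·(Θ^{g'}(x))^{S(g₀)} = Θ^{g₀g'}(x) for all g₀,g' ∈ G and label triples x. Define ^{g₀}F(a_g,b_h,c_k) := Θ^{g₀}(a_g,b_h,c_k)·ν₄(g₀,g,h,k)·(F¹(a_g,b_h,c_k))^{S(g₀)}. Then for all g₀ ∈ G and all labels: ^{g₀}F(a_g⊗b_h, c_k, d_l)·^{g₀}F(a_g, b_h, c_k⊗d_l) = ^{g₀}F(a_g,b_h,c_k)·^{g₀}F(a_g, b_h⊗c_k, d_l)·^{g₀g}F(b_h,c_k,d_l). -/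
/-- `z^{S(g)}`: complex conjugation of a unit of `ℂ` when the parity `s` is `1`. -/
noncomputable def cpowZ2 (s : ZMod 2) (z : ℂˣ) : ℂˣ :=
  if s = 1 then Units.map (starRingEnd ℂ).toMonoidHom z else z

/-- Fusion of labels `a_g ⊗ b_h = (a + b + μ g h)_{gh}`. -/
def fuseLabel {G N : Type*} [Group G] [AddCommGroup N] (μ : G → G → N)
    (x y : N × G) : N × G :=
  (x.1 + y.1 + μ x.2 y.2, x.2 * y.2)

theorem cpowZ2_mul (s : ZMod 2) (z w : ℂˣ) :
    cpowZ2 s (z * w) = cpowZ2 s z * cpowZ2 s w := by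
  unfold cpowZ2
  split_ifs <;> simp

theorem cpowZ2_add (s t : ZMod 2) (z : ℂˣ) :
    cpowZ2 (s + t) z = cpowZ2 s (cpowZ2 t z) := by
  have hs : ∀ u : ZMod 2, u = 0 ∨ u = 1 := by decide
  have h : (1 + 1 : ZMod 2) = 0 := rfl
  rcases hs s with rfl | rfl <;> rcases hs t with rfl | rfl <;> ext <;> simp [cpowZ2, h]

/-- consistency of the anomalous symmetric condition with the
surface fermionic pentagon equation (Abelian-gauge-theory surface). -/
theorem anomalous_symmetric_consistency {G N : Type*} [Group G] [AddCommGroup N]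
    (μ : G → G → N)
    (S : G → ZMod 2) (hS : ∀ g h : G, S (g * h) = S g + S h)
    (ν₄ : G → G → G → G → ℂˣ)
    (Θ : G → (N × G) → (N × G) → (N × G) → ℂˣ)
    (F1 : (N × G) → (N × G) → (N × G) → ℂˣ)
    -- (i) anomalous pentagon equation for the `g₀ = 1` F-moves
    (hpent : ∀ x y z w : N × G,
      F1 (fuseLabel μ x y) z w * F1 x y (fuseLabel μ z w) =
        Θ x.2 y z w * ν₄ x.2 y.2 z.2 w.2 *
          (F1 x y z * F1 x (fuseLabel μ y z) w * cpowZ2 (S x.2) (F1 y z w)))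
    -- (ii) fermionic-obstruction coboundary condition
    (hΘ : ∀ (g₀ : G) (x y z w : N × G),
      Θ g₀ (fuseLabel μ x y) z w * Θ g₀ x y (fuseLabel μ z w) *
          ν₄ g₀ (x.2 * y.2) z.2 w.2 * ν₄ g₀ x.2 y.2 (z.2 * w.2) *
          cpowZ2 (S g₀) (ν₄ x.2 y.2 z.2 w.2) =
        Θ g₀ x y z * Θ g₀ x (fuseLabel μ y z) w * Θ g₀ y z w *
          ν₄ g₀ x.2 y.2 z.2 * ν₄ g₀ x.2 (y.2 * z.2) w.2 * ν₄ (g₀ * x.2) y.2 z.2 w.2)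
    -- (iii) composition property of the fermionic obstruction
    (hcomp : ∀ (g₀ g' : G) (x y z : N × G),
      Θ g₀ x y z * cpowZ2 (S g₀) (Θ g' x y z) = Θ (g₀ * g') x y z) :
    -- conclusion: the `g₀`-decorated F-moves satisfy the pentagon equation
    ∀ (g₀ : G) (x y z w : N × G),
      (Θ g₀ (fuseLabel μ x y) z w * ν₄ g₀ (x.2 * y.2) z.2 w.2 *
          cpowZ2 (S g₀) (F1 (fuseLabel μ x y) z w)) *
        (Θ g₀ x y (fuseLabel μ z w) * ν₄ g₀ x.2 y.2 (z.2 * w.2) *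
          cpowZ2 (S g₀) (F1 x y (fuseLabel μ z w))) =
      (Θ g₀ x y z * ν₄ g₀ x.2 y.2 z.2 * cpowZ2 (S g₀) (F1 x y z)) *
        (Θ g₀ x (fuseLabel μ y z) w * ν₄ g₀ x.2 (y.2 * z.2) w.2 *
          cpowZ2 (S g₀) (F1 x (fuseLabel μ y z) w)) *
        (Θ (g₀ * x.2) y z w * ν₄ (g₀ * x.2) y.2 z.2 w.2 *
          cpowZ2 (S (g₀ * x.2)) (F1 y z w)) := by
  intro g₀ x y z w
  have hp := congrArg (cpowZ2 (S g₀)) (hpent x y z w)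
  simp only [cpowZ2_mul] at hp
  rw [← hcomp g₀ x.2 y z w, hS, cpowZ2_add, mul_mul_mul_comm, hp]
  have h := congrArg (· * (cpowZ2 (S g₀) (Θ x.2 y z w) * (cpowZ2 (S g₀) (F1 x y z) *
    cpowZ2 (S g₀) (F1 x (fuseLabel μ y z) w) *
    cpowZ2 (S g₀) (cpowZ2 (S x.2) (F1 y z w))))) (hΘ g₀ x y z w)
  simp only [mul_comm, mul_left_comm] at h ⊢
  exact h
end

section
/- Derivation of the fermionic obstruction from the obstructed pentagon equation (Appendix C, conclusion (i)). Let G be a group, N an additive abelian group, and S : G → Bool; for a nonzero complex number z set z^{S(g)} := conjugate of z if S(g) holds, and z otherwise. Let χ : N → G → G → ℂˣ (written χ_c(g,h)), α₃ : G³ → ℂˣ, ν₄ : G⁴ → ℂˣ, μ : G² → N, Θ : G → G → G → N → ℂˣ satisfy the normalizations χ_0(g,h)=1, α₃(g,h,1)=1, ν₄(g,h,k,1)=1 and μ(g,1)=0 for all g,h,k ∈ G. Define F(a_g,b_h,c_k) := χ_c(g,h)·α₃(g,h,k) on labels a_g (a ∈ N, g ∈ G) fused by a_g ⊗ b_h =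 (a+b+μ(g,h))_{gh}, and assume the obstructed pentagon equation: for all a,b,c,d ∈ N and g,h,k,l ∈ G, F(a_g⊗b_h, c_k, d_l)·F(a_g,b_h, c_k⊗d_l) = Θ(g,h,k,d)·ν₄(g,h,k,l)·F(a_g,b_h,c_k)·F(a_g, b_h⊗c_k, d_l)·(F(b_h,c_k,d_l))^{S(g)}. Then for all g,h,k ∈ G and d ∈ N: Θ(g,h,k,d) = χ_d(gh,k)·χ_d(g,h)·χ_d(g,hk)^{-1}·((χ_d(h,k))^{S(g)})^{-1}. -/
/-- `z^{S(g)}`: complex conjugation of a unit of `ℂ` when `b = true`. -/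
noncomputable def cconj (b : Bool) (z : ℂˣ) : ℂˣ :=
  if b then Units.map (starRingEnd ℂ).toMonoidHom z else z

/-- derived from the obstructed pentagon equation for the
factorized surface F-moves F(a_g,b_h,c_k) = χ_c(g,h)·α₃(g,h,k). -/
theorem fermionic_obstruction_formula {G N : Type*} [Group G] [AddCommGroup N]
    (S : G → Bool)
    (χ : N → G → G → ℂˣ) (α₃ : G → G → G → ℂˣ)
    (ν₄ : G → G → G → G → ℂˣ) (μ : G → G → N)
    (Θ : G → G → G → N → ℂˣ)
    (hχ0 : ∀ g h : G, χ 0 g h = 1)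
    (hα1 : ∀ g h : G, α₃ g h 1 = 1)
    (hν1 : ∀ g h k : G, ν₄ g h k 1 = 1)
    (hμ1 : ∀ g : G, μ g 1 = 0)
    -- obstructed pentagon equation for F(a_g,b_h,c_k) := χ_c(g,h)·α₃(g,h,k),
    -- with fusion a_g ⊗ b_h = (a+b+μ(g,h))_{gh}
    (hpent : ∀ (a b c d : N) (g h k l : G),
      (χ d (g * h) k * α₃ (g * h) k l) *
          (χ (c + d + μ k l) g h * α₃ g h (k * l)) =
        Θ g h k d * ν₄ g h k l *
          ((χ c g h * α₃ g h k) * (χ d g (h * k) * α₃ g (h * k) l) *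
            cconj (S g) (χ d h k * α₃ h k l))) :
    ∀ (g h k : G) (d : N),
      Θ g h k d =
        χ d (g * h) k * χ d g h * (χ d g (h * k))⁻¹ * (cconj (S g) (χ d h k))⁻¹ := by
  intro g h k d
  have hp := hpent 0 0 0 d g h k 1
  simp only [hα1, hν1, hμ1, hχ0, mul_one, one_mul, zero_add, add_zero] at hp
  rw [eq_mul_inv_iff_mul_eq, eq_mul_inv_iff_mul_eq]
  apply mul_right_cancel (b := α₃ g h k)
  calc Θ g h k d * cconj (S g) (χ d h k) * χ d g (h * k) * α₃ g h k
      = Θ g h k d * (α₃ g h k * χ d g (h * k) * cconj (S g) (χ d h k)) := by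
        simp only [mul_comm, mul_left_comm]
    _ = χ d (g * h) k * χ d g h * α₃ g h k := by rw [← hp, mul_assoc]
end

section
/- Derivation of the character property from the obstructed pentagon equation (Appendix C, conclusion (ii)). Let G be a group, N an additive abelian group, and S : G → Bool; for a nonzero complex number z set z^{S(g)} := conjugate of z if S(g) holds, and z otherwise. Let χ : N → G → G → ℂˣ (written χ_c(g,h)), α₃ : G³ → ℂˣ, ν₄ : G⁴ → ℂˣ, μ : G² → N, Θ : G → G → G → N → ℂˣ satisfy the normalizations χ_0(g,h)=1, α₃(g,h,1)=1, ν₄(g,h,k,1)=1 and μ(g,1)=0 for all g,h,k ∈ G. Define F(a_g,b_h,c_k) := χ_c(g,h)·α₃(g,h,k) on labels a_g (a ∈ N, g ∈ G) fused by a_g ⊗ b_h = (a+b+μ(g,h))_{gh}, and assume the obstructed pentagon equation: for all a,b,c,d ∈ N and g,h,k,l ∈ G, F(a_g⊗b_h, c_k, d_l)·F(a_g,b_h, c_k⊗d_l) = Θ(g,h,k,d)·ν₄(g,h,k,l)·F(a_g,b_h,c_k)·F(a_g, b_h⊗c_k, d_l)·(F(b_h,c_k,d_l))^{S(g)}. Then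 χ is a character in its N-argument: for all c,d ∈ N and g,h ∈ G, χ_{c+d}(g,h) = χ_c(g,h)·χ_d(g,h). -/
/-- derived from the obstructed pentagon equation for the
factorized surface F-moves F(a_g,b_h,c_k) = χ_c(g,h)·α₃(g,h,k). -/
theorem chi_is_character {G N : Type*} [Group G] [AddCommGroup N]
    (S : G → Bool)
    (χ : N → G → G → ℂˣ) (α₃ : G → G → G → ℂˣ)
    (ν₄ : G → G → G → G → ℂˣ) (μ : G → G → N)
    (Θ : G → G → G → N → ℂˣ)
    (hχ0 : ∀ g h : G, χ 0 g h = 1)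
    (hα1 : ∀ g h : G, α₃ g h 1 = 1)
    (hν1 : ∀ g h k : G, ν₄ g h k 1 = 1)
    (hμ1 : ∀ g : G, μ g 1 = 0)
    -- obstructed pentagon equation for F(a_g,b_h,c_k) := χ_c(g,h)·α₃(g,h,k),
    -- with fusion a_g ⊗ b_h = (a+b+μ(g,h))_{gh}
    (hpent : ∀ (a b c d : N) (g h k l : G),
      (χ d (g * h) k * α₃ (g * h) k l) *
          (χ (c + d + μ k l) g h * α₃ g h (k * l)) =
        Θ g h k d * ν₄ g h k l *
          ((χ c g h * α₃ g h k) * (χ d g (h * k) * α₃ g (h * k) l) *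
            cconj (S g) (χ d h k * α₃ h k l))) :
    ∀ (c d : N) (g h : G), χ (c + d) g h = χ c g h * χ d g h := by
  intro c d g h
  have hc := hpent 0 0 c d g h 1 1
  have h0 := hpent 0 0 0 d g h 1 1
  simp only [hμ1, hν1, hα1, hχ0, mul_one, one_mul, add_zero, zero_add] at hc h0
  apply mul_left_cancel (a := χ d (g * h) 1)
  rw [hc, mul_left_comm (χ d (g * h) 1), h0]
  simp only [mul_assoc, mul_left_comm (Θ g h 1 d)]
end

section
/- Derivation of the relation between χ, ν₄ and the coboundary of α₃ from the obstructed pentagon equation (Appendix C, conclusion (iii)). Let G be a group, N an additive abelian group, and S : G → Bool; for a nonzero complex number z set z^{S(g)} := conjugate of z if S(g) holds, and z otherwise. Let χ : N → G → G → ℂˣ (written χ_c(g,h)), α₃ : G³ → ℂˣ, ν₄ : G⁴ → ℂˣ, μ : G² → N, Θ : G → G → G → N → ℂˣ satisfy the normalizations χ_0(g,h)=1, α₃(g,h,1)=1, ν₄(g,h,k,1)=1 and μ(g,1)=0 for all g,h,k ∈ G. Define F(a_g,b_h,c_k) := χ_c(g,h)·α₃(g,h,k) on labels a_g (a ∈ N,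 g ∈ G) fused by a_g ⊗ b_h = (a+b+μ(g,h))_{gh}, and assume the obstructed pentagon equation: for all a,b,c,d ∈ N and g,h,k,l ∈ G, F(a_g⊗b_h, c_k, d_l)·F(a_g,b_h, c_k⊗d_l) = Θ(g,h,k,d)·ν₄(g,h,k,l)·F(a_g,b_h,c_k)·F(a_g, b_h⊗c_k, d_l)·(F(b_h,c_k,d_l))^{S(g)}. Then for all g,h,k,l ∈ G: χ_{μ(k,l)}(g,h) = ν₄(g,h,k,l)·α₃(g,h,k)·α₃(g,hk,l)·(α₃(h,k,l))^{S(g)}·α₃(gh,k,l)^{-1}·α₃(g,h,kl)^{-1}, i.e. χ_{μ(k,l)}(g,h) equals ν₄(g,h,k,l) times the S-twisted coboundary dα₃(g,h,k,l). -/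
/-- derived from the obstructed pentagon equation for the
factorized surface F-moves F(a_g,b_h,c_k) = χ_c(g,h)·α₃(g,h,k). -/
theorem chi_mu_equals_nu4_dalpha {G N : Type*} [Group G] [AddCommGroup N]
    (S : G → Bool)
    (χ : N → G → G → ℂˣ) (α₃ : G → G → G → ℂˣ)
    (ν₄ : G → G → G → G → ℂˣ) (μ : G → G → N)
    (Θ : G → G → G → N → ℂˣ)
    (hχ0 : ∀ g h : G, χ 0 g h = 1)
    (hα1 : ∀ g h : G, α₃ g h 1 = 1)
    (hν1 : ∀ g h k : G, ν₄ g h k 1 = 1)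
    (hμ1 : ∀ g : G, μ g 1 = 0)
    -- obstructed pentagon equation for F(a_g,b_h,c_k) := χ_c(g,h)·α₃(g,h,k),
    -- with fusion a_g ⊗ b_h = (a+b+μ(g,h))_{gh}
    (hpent : ∀ (a b c d : N) (g h k l : G),
      (χ d (g * h) k * α₃ (g * h) k l) *
          (χ (c + d + μ k l) g h * α₃ g h (k * l)) =
        Θ g h k d * ν₄ g h k l *
          ((χ c g h * α₃ g h k) * (χ d g (h * k) * α₃ g (h * k) l) *
            cconj (S g) (χ d h k * α₃ h k l))) :
    ∀ g h k l : G,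
      χ (μ k l) g h =
        ν₄ g h k l * α₃ g h k * α₃ g (h * k) l * cconj (S g) (α₃ h k l) *
          (α₃ (g * h) k l)⁻¹ * (α₃ g h (k * l))⁻¹ := by
  intro g h k l
  have hΘ : Θ g h k 0 = 1 := by
    have hp := hpent 0 0 0 0 g h k 1
    simpa [hχ0, hα1, hν1, hμ1, cconj] using hp
  have hp := hpent 0 0 0 0 g h k l
  simp only [hχ0, hΘ, one_mul, zero_add] at hp
  rw [eq_mul_inv_iff_mul_eq, eq_mul_inv_iff_mul_eq]
  simpa only [mul_assoc, mul_comm, mul_left_comm] using hp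
end

section
/- For G = ℤ/2 × ℤ/4 (additive, elements g = (g₁,g₂)), define ν₄ : G⁴ → ℂ by ν₄(g,h,k,l) := exp((π·i/2)·ĝ₂·ĥ₁·k̂₁·l̂₁), where ĝ₂ ∈ {0,1,2,3} and ĥ₁,k̂₁,l̂₁ ∈ {0,1} are the canonical integer representatives of g₂ ∈ ℤ/4 and h₁,k₁,l₁ ∈ ℤ/2. Then for all g₀,g,h,k,l ∈ G, the inhomogeneous coboundary satisfies dν₄(g₀,g,h,k,l) := ν₄(g,h,k,l)·ν₄(g₀+g,h,k,l)⁻¹·ν₄(g₀,g+h,k,l)·ν₄(g₀,g,h+k,l)⁻¹·ν₄(g₀,g,h,k+l)·ν₄(g₀,g,h,k)⁻¹ = (−1)^{(ĝ₀)₂·ĝ₁·ĥ₁·k̂₁·l̂₁}, i.e. dν₄ = (−1)^{n₃ ⌣₁ n₃} with n₃(g,h,k) = g₂h₁k₁ (mod 2) for the root ν = 1 bulk 3+1D fSPT phase with symmetry ℤ₂^f × ℤ₂ × ℤ₄. -/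
open Complex

/-- Bosonic 4-cochain of the root (ν = 1) 3+1D fSPT phase with symmetry
`ℤ₂^f × ℤ₂ × ℤ₄`: `ν₄(g,h,k,l) = exp((πi/2)·g₂h₁k₁l₁)`. -/
noncomputable def ν₄root (g h k l : ZMod 2 × ZMod 4) : ℂ :=
  Complex.exp ((Real.pi * Complex.I / 2) *
    ((g.2.val * h.1.val * k.1.val * l.1.val : ℕ) : ℂ))

theorem ν₄root_eq_I_zpow (g h k l : ZMod 2 × ZMod 4) :
    ν₄root g h k l = I ^ (g.2.val * h.1.val * k.1.val * l.1.val : ℤ) := by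
  have hI : Complex.exp (Real.pi * I / 2) = I := by
    rw [mul_div_right_comm, exp_pi_div_two_mul_I]
  rw [ν₄root, mul_comm, exp_nat_mul, hI, ← zpow_natCast]
  push_cast
  rfl

theorem ZMod.val_add_of_two (x y : ZMod 2) :
    ((x + y).val : ℤ) = x.val + y.val - 2 * (x.val * y.val) := by
  revert x y
  decide

theorem ZMod.exists_val_add_of_four (x y : ZMod 4) :
    ∃ c : ℤ, ((x + y).val : ℤ) = x.val + y.val - 4 * c :=
  ⟨(x.val + y.val : ℤ) / 4, by
    rw [ZMod.val_add]
    push_cast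
    omega⟩

theorem I_zpow_neg_two_mul_add_four_mul (n : ℕ) (m : ℤ) :
    I ^ (-2 * n + 4 * m : ℤ) = (-1 : ℂ) ^ n := by
  have h₂ : I ^ (-2 : ℤ) = -1 := by
    rw [zpow_neg, zpow_ofNat, I_sq, inv_neg, inv_one]
  have h₄ : I ^ (4 : ℤ) = 1 := by
    rw [zpow_ofNat, I_pow_four]
  rw [zpow_add₀ I_ne_zero, zpow_mul, zpow_mul, h₂, h₄, one_zpow, mul_one, zpow_natCast]

/-- the inhomogeneous coboundary of `ν₄root` equals
`(−1)^{(g₀)₂·g₁·h₁·k₁·l₁}`, i.e. `dν₄ = (−1)^{n₃ ⌣₁ n₃}`. -/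
theorem dnu4root_eq_minus_one_pow :
    ∀ g₀ g h k l : ZMod 2 × ZMod 4,
      ν₄root g h k l * (ν₄root (g₀ + g) h k l)⁻¹ * ν₄root g₀ (g + h) k l *
          (ν₄root g₀ g (h + k) l)⁻¹ * ν₄root g₀ g h (k + l) *
          (ν₄root g₀ g h k)⁻¹ =
        (-1 : ℂ) ^ (g₀.2.val * g.1.val * h.1.val * k.1.val * l.1.val) := by
  intro g₀ g h k l
  obtain ⟨c, hc⟩ := ZMod.exists_val_add_of_four g₀.2 g.2
  simp only [ν₄root_eq_I_zpow, ← zpow_neg, ← zpow_add₀ I_ne_zero, Prod.fst_add, Prod.snd_add,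
    ZMod.val_add_of_two, hc]
  rw [← I_zpow_neg_two_mul_add_four_mul _ (c * h.1.val * k.1.val * l.1.val)]
  congr 1
  push_cast
  ring
end

section
/- The bosonic (ν = 2) phase datum is a 4-cocycle: for G = ℤ/2 × ℤ/4 (additive, elements g = (g₁,g₂)), define ν₄ : G⁴ → ℂ by ν₄(g,h,k,l) := exp(π·i·ĝ₂·ĥ₁·k̂₁·l̂₁), where ĝ₂ ∈ {0,1,2,3} and ĥ₁,k̂₁,l̂₁ ∈ {0,1} are the canonical integer representatives of the components. Then for all g₀,g,h,k,l ∈ G: ν₄(g,h,k,l)·ν₄(g₀+g,h,k,l)⁻¹·ν₄(g₀,g+h,k,l)·ν₄(g₀,g,h+k,l)⁻¹·ν₄(g₀,g,h,k+l)·ν₄(g₀,g,h,k)⁻¹ = 1. -/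
/-- Bosonic 4-cochain of the ν = 2 (purely bosonic) 3+1D SPT phase with
symmetry `ℤ₂ × ℤ₄`: `ν₄(g,h,k,l) = exp(πi·g₂h₁k₁l₁)`. -/
noncomputable def ν₄bos (g h k l : ZMod 2 × ZMod 4) : ℂ :=
  Complex.exp ((Real.pi * Complex.I) *
    ((g.2.val * h.1.val * k.1.val * l.1.val : ℕ) : ℂ))

theorem ν₄bos_eq_neg_one_pow (g h k l : ZMod 2 × ZMod 4) :
    ν₄bos g h k l = (-1) ^ (g.2.val * h.1.val * k.1.val * l.1.val) := by
  rw [ν₄bos, mul_comm, Complex.exp_nat_mul, Complex.exp_pi_mul_I]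

/-- `ν₄bos` is a 4-cocycle: its inhomogeneous coboundary is 1. -/
theorem nu4bos_is_cocycle :
    ∀ g₀ g h k l : ZMod 2 × ZMod 4,
      ν₄bos g h k l * (ν₄bos (g₀ + g) h k l)⁻¹ * ν₄bos g₀ (g + h) k l *
          (ν₄bos g₀ g (h + k) l)⁻¹ * ν₄bos g₀ g h (k + l) *
          (ν₄bos g₀ g h k)⁻¹ = 1 := by
  intro g₀ g h k l
  have inv_neg_one_pow (n : ℕ) : ((-1 : ℂ) ^ n)⁻¹ = (-1) ^ n := by
    rw [← inv_pow, inv_neg_one]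
  have val_add_fst (a b : ZMod 2) : ((a + b).val : ZMod 2) = a.val + b.val := by simp
  have val_add_snd (a b : ZMod 4) : ((a + b).val : ZMod 2) = a.val + b.val := by simp
  have two_eq_zero : (2 : ZMod 2) = 0 := rfl
  simp only [ν₄bos_eq_neg_one_pow, inv_neg_one_pow, ← pow_add]
  apply Even.neg_one_pow
  rw [← ZMod.natCast_eq_zero_iff_even]
  simp only [Nat.cast_add, Nat.cast_mul, Prod.fst_add, Prod.snd_add, val_add_fst, val_add_snd]
  linear_combination
    ((g.2.val : ZMod 2) * h.1.val * k.1.val * l.1.val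
      + g₀.2.val * h.1.val * k.1.val * l.1.val + g₀.2.val * g.1.val * k.1.val * l.1.val
      + g₀.2.val * g.1.val * h.1.val * l.1.val + g₀.2.val * g.1.val * h.1.val * k.1.val)
      * two_eq_zero
end

section
/- The fermionic obstruction Θ^{g₀}(a_g,b_h,c_k) = (−1)^{(ĝ₀)₂·ĝ₁·ĥ₁·ĉ} solves the obstruction equation for the surface ℤ₄ gauge theory with ℤ₂^f × ℤ₂ × ℤ₄ symmetry: let G = ℤ/2 × ℤ/4 (additive, g = (g₁,g₂)), and for c,d ∈ ℤ/4 write ĉ, d̂ ∈ {0,1,2,3} and ĝ₁ ∈ {0,1}, ĝ₂ ∈ {0,1,2,3} for canonical integer representatives. Then for all g₀,g,h,k,l ∈ G and c,d ∈ ℤ/4: (−1)^{(ĝ₀)₂·((g+h)₁)^·k̂₁·d̂} · (−1)^{(ĝ₀)₂·ĝ₁·ĥ₁·(c+d+κ)^} = (−1)^{(ĝ₀)₂·ĝ₁·ĥ₁·ĉ} · (−1)^{(ĝ₀)₂·ĝ₁·((h+k)₁)^·d̂} · (−1)^{(ĝ₀)₂·ĥ₁·k̂₁·d̂} · (−1)^{(ĝ₀)₂·ĝ₁·ĥ₁·k̂₁·l̂₁},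 where κ ∈ ℤ/4 is the cast of k̂₁·l̂₁ and (c+d+κ)^ denotes the integer representative of c+d+κ ∈ ℤ/4, and ((g+h)₁)^ the integer representative of g₁+h₁ ∈ ℤ/2. (Equivalently: the Θ-quotient of Eq.(omega) equals dν₄(g₀,g,h,k,l) = (−1)^{(g₀)₂g₁h₁k₁l₁}.) -/
/-- A power of `-1` depends only on the class of its exponent modulo `2`. -/
lemma neg_one_pow_eq_of_natCast_eq {R : Type*} [Monoid R] [HasDistribNeg R] {m n : ℕ}
    (h : (m : ZMod 2) = n) : (-1 : R) ^ m = (-1 : R) ^ n :=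
  neg_one_pow_congr <| by
    rw [← ZMod.natCast_eq_zero_iff_even, ← ZMod.natCast_eq_zero_iff_even, h]

/-- The parity of canonical representatives is additive in `ZMod n` for even `n`. -/
lemma ZMod.natCast_val_add_of_even {n : ℕ} [NeZero n] (hn : 2 ∣ n) (a b : ZMod n) :
    (((a + b).val : ℕ) : ZMod 2) = a.val + b.val := by
  simp only [ZMod.natCast_val, ZMod.cast_add hn]

/-- Reducing a natural number modulo an even `n` preserves its parity. -/
lemma ZMod.natCast_val_natCast_of_even {n : ℕ} [NeZero n] (hn : 2 ∣ n) (m : ℕ) :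
    (((m : ZMod n).val : ℕ) : ZMod 2) = m := by
  rw [ZMod.natCast_val, ZMod.cast_natCast hn]

/-- the fermionic obstruction
`Θ^{g₀}(a_g,b_h,c_k) = (−1)^{(g₀)₂·g₁·h₁·c}` solves the obstruction equation
for the surface `ℤ₄` gauge theory with `ℤ₂^f × ℤ₂ × ℤ₄` symmetry. -/
theorem theta_solves_obstruction_equation :
    ∀ g₀ g h k l : ZMod 2 × ZMod 4, ∀ c d : ZMod 4,
      (-1 : ℂ) ^ (g₀.2.val * (g + h).1.val * k.1.val * d.val) *
        (-1 : ℂ) ^ (g₀.2.val * g.1.val * h.1.val *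
          (c + d + ((k.1.val * l.1.val : ℕ) : ZMod 4)).val) =
      (-1 : ℂ) ^ (g₀.2.val * g.1.val * h.1.val * c.val) *
        (-1 : ℂ) ^ (g₀.2.val * g.1.val * (h + k).1.val * d.val) *
        (-1 : ℂ) ^ (g₀.2.val * h.1.val * k.1.val * d.val) *
        (-1 : ℂ) ^ (g₀.2.val * g.1.val * h.1.val * k.1.val * l.1.val) := by
  intro g₀ g h k l c d
  simp only [← pow_add]
  apply neg_one_pow_eq_of_natCast_eq
  have h₄ : 2 ∣ 4 := by norm_num
  push_cast [Prod.fst_add, ZMod.natCast_val_add_of_even dvd_rfl,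
    ZMod.natCast_val_add_of_even h₄]
  rw [← Nat.cast_mul (α := ZMod 4), ZMod.natCast_val_natCast_of_even h₄, Nat.cast_mul]
  ring
end

section
/- The surface F-moves of the ℤ₄ gauge theory with ℤ₂^f × ℤ₂ × ℤ₄ symmetry satisfy the 't Hooft anomalous fermionic pentagon equation (leftmost group element trivial): let G = ℤ/2 × ℤ/4 (additive, g = (g₁,g₂)); for labels a,b,c,d ∈ ℤ/4 and gradings define F(a_g,b_h,c_k) := exp((π·i/2)·ĝ₂·ĥ₁·ĉ) (depending only on g₂, h₁ and the value of the third label), and the fusion a_g ⊗ b_h := (a+b+γ)_{g+h} where γ ∈ ℤ/4 is the cast of ĝ₁·ĥ₁. Then for all g,h,k,l ∈ G and a,b,c,d ∈ ℤ/4: F((a⊗b)_{g+h}, c_k, d_l) · F(a_g, b_h, (c⊗d)_{k+l}) = (−1)^{ĝ₂·ĥ₁·k̂₁·d̂} · exp((π·i/2)·ĝ₂·ĥ₁·k̂₁·l̂₁) · F(a_g,b_h,c_k) · F(a_g, (b⊗c)_{h+k}, d_l) · F(b_h,c_k,d_l). Explicitly: exp((πi/2)·((g+h)₂)^·k̂₁·d̂)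 · exp((πi/2)·ĝ₂·ĥ₁·(c+d+κ)^) = (−1)^{ĝ₂ĥ₁k̂₁d̂} · exp((πi/2)·ĝ₂ĥ₁k̂₁l̂₁) · exp((πi/2)·ĝ₂ĥ₁ĉ) · exp((πi/2)·ĝ₂·((h+k)₁)^·d̂) · exp((πi/2)·ĥ₂k̂₁d̂), where κ ∈ ℤ/4 is the cast of k̂₁·l̂₁ and x̂/(x)^ denote canonical integer representatives. -/
/-- The exponential `exp ((πi/2)·n)` is the `n`-th power of `i`. -/
lemma exp_pi_mul_I_div_two_mul_natCast (n : ℕ) :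
    Complex.exp ((Real.pi * Complex.I / 2) * (n : ℂ)) = Complex.I ^ n := by
  rw [mul_comm, Complex.exp_nat_mul, mul_div_right_comm, Complex.exp_pi_div_two_mul_I]

/-- Powers of `i` depend only on the exponent modulo four. -/
lemma Complex.I_pow_eq_of_natCast_eq {m n : ℕ} (h : (m : ZMod 4) = n) :
    Complex.I ^ m = Complex.I ^ n := by
  rw [Complex.I_pow_eq_pow_mod m, Complex.I_pow_eq_pow_mod n, (ZMod.natCast_eq_natCast_iff' m n 4).1 h]

/-- The representative of a sum in `ZMod 2`, reduced modulo four. -/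
lemma ZMod.natCast_val_add_two (x y : ZMod 2) :
    ((x + y).val : ZMod 4) = x.val + y.val + 2 * x.val * y.val := by
  revert x y
  decide

/-- the surface F-moves
`F(a_g,b_h,c_k) = exp((πi/2)·g₂·h₁·c)` of the `ℤ₄` gauge theory with
`ℤ₂^f × ℤ₂ × ℤ₄` symmetry satisfy the 't Hooft anomalous fermionic pentagon
equation (leftmost group element trivial). -/
theorem anomalous_pentagon_trivial_leftmost :
    ∀ g h k l : ZMod 2 × ZMod 4, ∀ a b c d : ZMod 4,
      Complex.exp ((Real.pi * Complex.I / 2) *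
          (((g + h).2.val * k.1.val * d.val : ℕ) : ℂ)) *
        Complex.exp ((Real.pi * Complex.I / 2) *
          ((g.2.val * h.1.val *
            (c + d + ((k.1.val * l.1.val : ℕ) : ZMod 4)).val : ℕ) : ℂ)) =
      (-1 : ℂ) ^ (g.2.val * h.1.val * k.1.val * d.val) *
        Complex.exp ((Real.pi * Complex.I / 2) *
          ((g.2.val * h.1.val * k.1.val * l.1.val : ℕ) : ℂ)) *
        Complex.exp ((Real.pi * Complex.I / 2) *
          ((g.2.val * h.1.val * c.val : ℕ) : ℂ)) *
        Complex.exp ((Real.pi * Complex.I / 2) *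
          ((g.2.val * (h + k).1.val * d.val : ℕ) : ℂ)) *
        Complex.exp ((Real.pi * Complex.I / 2) *
          ((h.2.val * k.1.val * d.val : ℕ) : ℂ)) := by
  intro g h k l _ _ c d
  have four_eq_zero : (4 : ZMod 4) = 0 := rfl
  simp only [exp_pi_mul_I_div_two_mul_natCast]
  rw [← Complex.I_sq, ← pow_mul]
  simp only [← pow_add]
  apply Complex.I_pow_eq_of_natCast_eq
  push_cast
  rw [Prod.fst_add, ZMod.natCast_val_add_two]
  simp only [Prod.snd_add, ZMod.natCast_zmod_val]
  linear_combination (-(g.2 * h.1.val * k.1.val * d)) * four_eq_zero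
end

section
/- Computation of the o₃ obstruction for the surface ℤ₄ gauge theory with ℤ₂^f × ℤ₂ × ℤ₄ symmetry: let G = ℤ/2 × ℤ/4 (additive, g = (g₁,g₂)) and A = ℤ/4 × ℤ/4 × ℤ/2 (additive). Define ρ : G → (A → A) by ρ_g(a_m, a_e, a_f) := (a_m, a_e + 2·g₂·a_m, a_f + r(g₂·a_m)), where r : ℤ/4 → ℤ/2 is the reduction ring homomorphism, and define 𝔴 : G×G → A by 𝔴(g,h) := (ι(ĝ₁·ĥ₁), g₂·ι(ĥ₁), 0), where ι : ℕ → ℤ/4 is the cast and ĝ₁, ĥ₁ ∈ {0,1} are the representatives of g₁,h₁ ∈ ℤ/2. Then for all g,h,k ∈ G, the ρ-twisted coboundary d𝔴(g,h,k) := ρ_g(𝔴(h,k)) − 𝔴(g+h,k) + 𝔴(g,h+k) − 𝔴(g,h) equals (0, 0, r(g₂)·h₁·k₁) in A. -/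
/-- The reduction ring homomorphism `ℤ/4 → ℤ/2`. -/
def red42 : ZMod 4 →+* ZMod 2 := ZMod.castHom (show (2:ℕ) ∣ 4 by norm_num) (ZMod 2)

/-- Symmetry action on Abelian anyons `(a_m, a_e, a_f)` of the surface
`Z₁(Vec_{ℤ₄}) ⊠ {1,f}` topological order:
`ρ_g(a_m,a_e,a_f) = (a_m, a_e + 2g₂a_m, a_f + g₂a_m mod 2)`. -/
def ρanyon (g : ZMod 2 × ZMod 4) (a : ZMod 4 × ZMod 4 × ZMod 2) :
    ZMod 4 × ZMod 4 × ZMod 2 :=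
  (a.1, a.2.1 + 2 * g.2 * a.1, a.2.2 + red42 (g.2 * a.1))

/-- Symmetry fractionalization 2-cochain `𝔴(g,h) = (g₁h₁, g₂h₁, 0)`. -/
def 𝔴frac (g h : ZMod 2 × ZMod 4) : ZMod 4 × ZMod 4 × ZMod 2 :=
  (((g.1.val * h.1.val : ℕ) : ZMod 4), g.2 * ((h.1.val : ℕ) : ZMod 4), 0)

/-- The representatives in `{0, 1}` of a sum in `ℤ/2`, viewed in any commutative ring. -/
theorem natCast_val_add_zmod_two {R : Type*} [CommRing R] (a b : ZMod 2) :
    (((a + b).val : ℕ) : R) = a.val + b.val - 2 * a.val * b.val := by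
  have key : (a + b).val + 2 * a.val * b.val = a.val + b.val := by
    revert a b; decide
  have := congrArg (Nat.cast : ℕ → R) key
  push_cast at this
  exact eq_sub_of_add_eq this

/-- the ρ-twisted coboundary of `𝔴frac` equals
`(0, 0, g₂h₁k₁)`, the nontrivial `o₃ ∈ H³(G,ℤ₂)` obstruction. -/
theorem o3_obstruction_computation :
    ∀ g h k : ZMod 2 × ZMod 4,
      ρanyon g (𝔴frac h k) - 𝔴frac (g + h) k + 𝔴frac g (h + k) - 𝔴frac g h =
        (0, 0, red42 g.2 * h.1 * k.1) := by
  intro g h k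
  simp only [ρanyon, 𝔴frac, Prod.mk_add_mk, Prod.mk_sub_mk, Prod.mk.injEq, Prod.fst_add,
    Prod.snd_add, Nat.cast_mul, natCast_val_add_zmod_two]
  refine ⟨by ring, by ring, ?_⟩
  simp only [map_mul, map_natCast, ZMod.natCast_zmod_val]
  ring
end

section
/- The ν = 2 bosonic surface F-moves satisfy the obstructed pentagon equation: let G = ℤ/2 × ℤ/4 (additive, g = (g₁,g₂)); for labels a,b,c,d ∈ ℤ/4 define F(a_g,b_h,c_k) := exp(π·i·ĝ₂·ĥ₁·ĉ) (depending only on g₂, h₁ and the value of the third label) and the fusion a_g ⊗ b_h := (a+b+γ)_{g+h} where γ ∈ ℤ/4 is the cast of ĝ₁·ĥ₁. Then for all g,h,k,l ∈ G and a,b,c,d ∈ ℤ/4: F((a⊗b)_{g+h}, c_k, d_l)·F(a_g, b_h, (c⊗d)_{k+l}) = exp(π·i·ĝ₂·ĥ₁·k̂₁·l̂₁)·F(a_g,b_h,c_k)·F(a_g,(b⊗c)_{h+k},d_l)·F(b_h,c_k,d_l). Explicitly: exp(πi·((g+h)₂)^·k̂₁·d̂)·exp(πi·ĝ₂·ĥ₁·(c+d+κ)^)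 = exp(πi·ĝ₂ĥ₁k̂₁l̂₁)·exp(πi·ĝ₂ĥ₁ĉ)·exp(πi·ĝ₂·((h+k)₁)^·d̂)·exp(πi·ĥ₂k̂₁d̂), where κ ∈ ℤ/4 is the cast of k̂₁·l̂₁. -/
theorem exp_pi_mul_I_mul_natCast (n : ℕ) :
    Complex.exp ((Real.pi * Complex.I) * (n : ℂ)) = (-1) ^ n := by
  rw [mul_comm, Complex.exp_nat_mul, Complex.exp_pi_mul_I]

theorem neg_one_pow_eq_of_natCast_zmod_two_eq {R : Type*} [Monoid R] [HasDistribNeg R]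
    {m n : ℕ} (h : (m : ZMod 2) = n) : (-1 : R) ^ m = (-1) ^ n := by
  apply neg_one_pow_congr
  rw [← ZMod.natCast_eq_zero_iff_even, ← ZMod.natCast_eq_zero_iff_even, h]

theorem ZMod.natCast_val_add_of_dvd {m n : ℕ} (h : m ∣ n) [NeZero n] (x y : ZMod n) :
    ((x + y).val : ZMod m) = x.val + y.val := by
  simp only [ZMod.natCast_val]
  exact ZMod.cast_add h x y

theorem ZMod.natCast_val_natCast_of_dvd {m n : ℕ} (h : m ∣ n) [NeZero n] (k : ℕ) :
    (((k : ZMod n)).val : ZMod m) = k := by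
  simp only [ZMod.natCast_val]
  exact ZMod.cast_natCast h k

/-- the ν = 2 bosonic surface F-moves
`F(a_g,b_h,c_k) = exp(πi·g₂·h₁·c)` satisfy the obstructed pentagon equation
with bosonic obstruction `ν₄(g,h,k,l) = exp(πi·g₂h₁k₁l₁)`. -/
theorem bosonic_obstructed_pentagon :
    ∀ g h k l : ZMod 2 × ZMod 4, ∀ a b c d : ZMod 4,
      Complex.exp ((Real.pi * Complex.I) *
          (((g + h).2.val * k.1.val * d.val : ℕ) : ℂ)) *
        Complex.exp ((Real.pi * Complex.I) *
          ((g.2.val * h.1.val *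
            (c + d + ((k.1.val * l.1.val : ℕ) : ZMod 4)).val : ℕ) : ℂ)) =
      Complex.exp ((Real.pi * Complex.I) *
          ((g.2.val * h.1.val * k.1.val * l.1.val : ℕ) : ℂ)) *
        Complex.exp ((Real.pi * Complex.I) *
          ((g.2.val * h.1.val * c.val : ℕ) : ℂ)) *
        Complex.exp ((Real.pi * Complex.I) *
          ((g.2.val * (h + k).1.val * d.val : ℕ) : ℂ)) *
        Complex.exp ((Real.pi * Complex.I) *
          ((h.2.val * k.1.val * d.val : ℕ) : ℂ)) := by
  intro g h k l a b c d
  simp only [exp_pi_mul_I_mul_natCast, ← pow_add]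
  apply neg_one_pow_eq_of_natCast_zmod_two_eq
  have h₂ : 2 ∣ 2 := dvd_rfl
  have h₄ : 2 ∣ 4 := ⟨2, rfl⟩
  have hκ := ZMod.natCast_val_natCast_of_dvd h₄ (k.1.val * l.1.val)
  generalize ((k.1.val * l.1.val : ℕ) : ZMod 4) = κ at hκ ⊢
  simp only [Nat.cast_add, Nat.cast_mul, Prod.fst_add, Prod.snd_add,
    ZMod.natCast_val_add_of_dvd h₂, ZMod.natCast_val_add_of_dvd h₄, hκ]
  ring
end
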